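/- Let 𝔾 be a finite connected transitive graph and p ∈ [0,1]. (i) For every real k ≥ 1, P_{≥k}(p) ≤ (e/(e−1))·M(p, k^{-1}). (ii) For every k > 0 and every 0 < γ̃ ≤ 1 and 0 ≤ γ ≤ 1, P_{≥k}(p) ≥ M(p,γ) − (γ/γ̃)·e^{γ̃k}·M(p,γ̃). -/

import Mathlib

noncomputable section
open Classical

namespace Percolation

variable {V : Type*} [Fintype V] [DecidableEq V]

/-- A percolation configuration: an assignment of occupied (`true`) or
vacant (`false`) to each bond of the graph. -/
def Config (G : SimpleGraph V) : Type _ := G.edgeSet → Bool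

noncomputable instance (G : SimpleGraph V) : Fintype G.edgeSet :=
  Fintype.ofFinite _

noncomputable instance (G : SimpleGraph V) : Fintype (Config G) :=
  inferInstanceAs (Fintype (G.edgeSet → Bool))

/-- The probability weight of a configuration under the product Bernoulli
measure with parameter `p`. -/
def weight (G : SimpleGraph V) (p : ℝ) (ω : Config G) : ℝ :=
  ∏ e : G.edgeSet, if ω e then p else 1 - p

/-- The probability of an event under the percolation measure `ℙ_p`. -/
def prob (G : SimpleGraph V) (p : ℝ) (A : Config G → Prop) : ℝ :=
  ∑ ω : Config G, if A ω then weight G p ω else 0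

/-- The expectation of a random variable under the percolation measure `ℙ_p`. -/
def expect (G : SimpleGraph V) (p : ℝ) (f : Config G → ℝ) : ℝ :=
  ∑ ω : Config G, weight G p ω * f ω

/-- The subgraph consisting of the occupied bonds of a configuration. -/
def occupied (G : SimpleGraph V) (ω : Config G) : SimpleGraph V :=
  SimpleGraph.fromEdgeSet {e | ∃ h : e ∈ G.edgeSet, ω ⟨e, h⟩ = true}

/-- The cluster `C(x)` of the vertex `x`: all vertices joined to `x` by a path
of occupied bonds (including `x` itself). -/
def cluster (G : SimpleGraph V) (ω : Config G) (x : V) : Finset V :=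
  Finset.univ.filter fun y => (occupied G ω).Reachable x y

/-- The susceptibility `χ(p)`: the expected size of the cluster of `x₀`. -/
def chi (G : SimpleGraph V) (x₀ : V) (p : ℝ) : ℝ :=
  expect G p fun ω => ((cluster G ω x₀).card : ℝ)

/-- The two-point function `τ_p(x,y) = ℙ_p(x ↔ y)`. -/
def tau (G : SimpleGraph V) (p : ℝ) (x y : V) : ℝ :=
  prob G p fun ω => (occupied G ω).Reachable x y

/-- The triangle diagram `∇_p(x,y)`. -/
def triangle (G : SimpleGraph V) (p : ℝ) (x y : V) : ℝ :=
  ∑ u : V, ∑ v : V, tau G p x u * tau G p u v * tau G p v y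

/-- The Kronecker delta `δ_{x,y}`. -/
def kron (x y : V) : ℝ := if x = y then 1 else 0

/-- `∇̄_p`: the maximum of the triangle diagram over bonds `{x,y} ∈ 𝔹`. -/
def nablaBar (G : SimpleGraph V) (p : ℝ) : ℝ :=
  sSup {t : ℝ | ∃ x y : V, G.Adj x y ∧ t = triangle G p x y}

/-- A graph is (vertex-)transitive if any vertex can be mapped to any other
by a graph automorphism. -/
def IsTransitive (G : SimpleGraph V) : Prop :=
  ∀ x y : V, ∃ φ : G ≃g G, φ x = y

/-- The size `|C_max|` of the largest cluster. -/
def maxCluster (G : SimpleGraph V) (ω : Config G) : ℕ :=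
  Finset.univ.sup fun x => (cluster G ω x).card

/-- The cluster size distribution `P_{≥k}(p) = ℙ_p(|C(x₀)| ≥ k)`. -/
def Pgeq (G : SimpleGraph V) (x₀ : V) (p : ℝ) (k : ℝ) : ℝ :=
  prob G p fun ω => k ≤ ((cluster G ω x₀).card : ℝ)

/-- The magnetization `M(p,γ)`. -/
def magnetization (G : SimpleGraph V) (x₀ : V) (p γ : ℝ) : ℝ :=
  ∑ k ∈ Finset.Icc 1 (Fintype.card V),
    (1 - (1 - γ) ^ k) * prob G p fun ω => (cluster G ω x₀).card = k

/-- `Z_{≥s}`: the number of vertices lying in clusters of size at least `s`. -/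
def Zgeq (G : SimpleGraph V) (s : ℝ) (ω : Config G) : ℝ :=
  ∑ x : V, if s ≤ ((cluster G ω x).card : ℝ) then (1 : ℝ) else 0

/-- The variance of a random variable under `ℙ_p`. -/
def variance (G : SimpleGraph V) (p : ℝ) (f : Config G → ℝ) : ℝ :=
  expect G p (fun ω => f ω ^ 2) - (expect G p f) ^ 2

/-- The restricted susceptibility `χ_{≥s}(p) = 𝔼_p[|C(x₀)| I[|C(x₀)| ≥ s]]`. -/
def chiGeq (G : SimpleGraph V) (x₀ : V) (p : ℝ) (s : ℝ) : ℝ :=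
  expect G p fun ω =>
    if s ≤ ((cluster G ω x₀).card : ℝ) then ((cluster G ω x₀).card : ℝ) else 0

/-- The restricted susceptibility `χ_{<s}(p) = 𝔼_p[|C(x₀)| I[|C(x₀)| < s]]`. -/
def chiLt (G : SimpleGraph V) (x₀ : V) (p : ℝ) (s : ℝ) : ℝ :=
  expect G p fun ω =>
    if ((cluster G ω x₀).card : ℝ) < s then ((cluster G ω x₀).card : ℝ) else 0

end Percolation
namespace Percolation

variable {V : Type*} [Fintype V] [DecidableEq V]

theorem weight_nonneg' (G : SimpleGraph V) (p : ℝ) (hp0 : 0 ≤ p) (hp1 : p ≤ 1)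
    (ω : Config G) : 0 ≤ weight G p ω := by
  unfold weight
  apply Finset.prod_nonneg
  intro e _
  split_ifs <;> linarith

theorem cluster_card_mem (G : SimpleGraph V) (ω : Config G) (x : V) :
    (cluster G ω x).card ∈ Finset.Icc 1 (Fintype.card V) := by
  rw [Finset.mem_Icc]
  refine ⟨?_, Finset.card_le_univ _⟩
  apply Finset.card_pos.mpr
  exact ⟨x, by simp [cluster]⟩

theorem magnetization_eq (G : SimpleGraph V) (x₀ : V) (p γ : ℝ) :
    magnetization G x₀ p γ =
      ∑ ω : Config G, weight G p ω * (1 - (1 - γ) ^ (cluster G ω x₀).card) := by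
  unfold magnetization prob
  simp_rw [Finset.mul_sum]
  rw [Finset.sum_comm]
  refine Finset.sum_congr rfl fun ω _ => ?_
  rw [Finset.sum_eq_single (cluster G ω x₀).card]
  · rw [if_pos rfl, mul_comm]
  · intro b _ hb
    rw [if_neg (Ne.symm hb), mul_zero]
  · intro h
    exact absurd (cluster_card_mem G ω x₀) h

theorem one_sub_pow_le_exp (γ : ℝ) (h1 : γ ≤ 1) (n : ℕ) :
    (1 - γ) ^ n ≤ Real.exp (-(γ * n)) := by
  have h : 1 - γ ≤ Real.exp (-γ) := by
    have := Real.add_one_le_exp (-γ)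
    linarith
  calc (1 - γ) ^ n ≤ Real.exp (-γ) ^ n := pow_le_pow_left₀ (by linarith) h n
    _ = Real.exp (-(γ * n)) := by
      rw [← Real.exp_nat_mul]
      congr 1
      ring

theorem pointwise_one (k : ℝ) (hk : 1 ≤ k) (n : ℕ) :
    (if k ≤ (n : ℝ) then (1 : ℝ) else 0) ≤
      (Real.exp 1 / (Real.exp 1 - 1)) * (1 - (1 - k⁻¹) ^ n) := by
  have hk0 : 0 < k := by linarith
  have hinv : k⁻¹ ≤ 1 := inv_le_one_of_one_le₀ hk
  have hinv0 : 0 < k⁻¹ := inv_pos.mpr hk0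
  have he : 0 < Real.exp 1 - 1 := by
    have := Real.add_one_lt_exp (x := 1) one_ne_zero
    linarith
  have hE := Real.exp_pos 1
  split_ifs with h
  · have h1 := one_sub_pow_le_exp k⁻¹ hinv n
    have h2 : (1 : ℝ) ≤ k⁻¹ * n := by
      rw [inv_mul_eq_div, le_div_iff₀ hk0]
      linarith
    have h3 : Real.exp (-(k⁻¹ * n)) ≤ Real.exp (-1) := Real.exp_le_exp.mpr (by linarith)
    have h4 : 1 - (Real.exp 1)⁻¹ ≤ 1 - (1 - k⁻¹) ^ n := by
      rw [← Real.exp_neg]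
      linarith
    calc (1 : ℝ) = (Real.exp 1 / (Real.exp 1 - 1)) * (1 - (Real.exp 1)⁻¹) := by
          field_simp
      _ ≤ _ := mul_le_mul_of_nonneg_left h4 (by positivity)
  · have : (1 - k⁻¹) ^ n ≤ 1 := pow_le_one₀ (by linarith) (by linarith)
    apply mul_nonneg (by positivity)
    linarith

theorem pointwise_two (k γ γt : ℝ) (h0 : 0 ≤ γ) (h1 : γ ≤ 1) (ht0 : 0 < γt)
    (ht1 : γt ≤ 1) (n : ℕ) :
    (1 - (1 - γ) ^ n) - (γ / γt) * Real.exp (γt * k) * (1 - (1 - γt) ^ n) ≤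
      (if k ≤ (n : ℝ) then (1 : ℝ) else 0) := by
  have ha : (1 - γt) ^ n ≤ 1 := pow_le_one₀ (by linarith) (by linarith)
  have hb : 0 ≤ (1 - γ) ^ n := pow_nonneg (by linarith) n
  have hq : 0 ≤ γ / γt := div_nonneg h0 ht0.le
  split_ifs with h
  · have : 0 ≤ (γ / γt) * Real.exp (γt * k) * (1 - (1 - γt) ^ n) :=
      mul_nonneg (mul_nonneg hq (Real.exp_pos _).le) (by linarith)
    linarith
  · push Not at h
    have hbern : 1 + (n : ℝ) * (-γ) ≤ (1 + -γ) ^ n :=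
      one_add_mul_le_pow (by linarith) n
    rw [← sub_eq_add_neg] at hbern
    have hexp := one_sub_pow_le_exp γt ht1 n
    have hle : Real.exp (γt * n) ≤ Real.exp (γt * k) :=
      Real.exp_le_exp.mpr (mul_le_mul_of_nonneg_left h.le ht0.le)
    have hkey : γt * n ≤ Real.exp (γt * k) * (1 - (1 - γt) ^ n) := by
      calc γt * n ≤ Real.exp (γt * n) - 1 := by
            have := Real.add_one_le_exp (γt * n)
            linarith
        _ = Real.exp (γt * n) * (1 - Real.exp (-(γt * n))) := by
            rw [mul_sub, ← Real.exp_add]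
            simp
        _ ≤ Real.exp (γt * n) * (1 - (1 - γt) ^ n) :=
            mul_le_mul_of_nonneg_left (by linarith) (Real.exp_pos _).le
        _ ≤ _ := mul_le_mul_of_nonneg_right hle (by linarith)
    have h5 := mul_le_mul_of_nonneg_left hkey hq
    have h6 : γ / γt * (γt * n) = γ * n := by field_simp
    rw [h6, ← mul_assoc] at h5
    linarith

theorem Pgeq_eq (G : SimpleGraph V) (x₀ : V) (p k : ℝ) :
    Pgeq G x₀ p k = ∑ ω : Config G, weight G p ω *
      (if k ≤ ((cluster G ω x₀).card : ℝ) then (1 : ℝ) else 0) := by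
  unfold Pgeq prob
  refine Finset.sum_congr rfl fun ω _ => ?_
  split_ifs <;> simp

end Percolation

open Percolation in
/-- Lemma 5.2: the cluster size distribution is controlled by the
magnetization, and vice versa. -/
theorem cluster_size_distribution_magnetization
    {V : Type*} [Fintype V] [DecidableEq V]
    (G : SimpleGraph V) [DecidableRel G.Adj]
    (hconn : G.Connected) (htrans : IsTransitive G)
    (x₀ : V)
    (p : ℝ) (hp0 : 0 ≤ p) (hp1 : p ≤ 1) :
    (∀ k : ℝ, 1 ≤ k →
        Pgeq G x₀ p k ≤
          (Real.exp 1 / (Real.exp 1 - 1)) * magnetization G x₀ p k⁻¹) ∧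
      (∀ k γ γt : ℝ, 0 < k → 0 ≤ γ → γ ≤ 1 → 0 < γt → γt ≤ 1 →
        Pgeq G x₀ p k ≥
          magnetization G x₀ p γ -
            (γ / γt) * Real.exp (γt * k) * magnetization G x₀ p γt) := by
  constructor
  · intro k hk
    rw [Pgeq_eq, magnetization_eq, Finset.mul_sum]
    refine Finset.sum_le_sum fun ω _ => ?_
    have h := mul_le_mul_of_nonneg_left (pointwise_one k hk (cluster G ω x₀).card)
      (weight_nonneg' G p hp0 hp1 ω)
    linarith
  · intro k γ γt _ h0 h1 ht0 ht1
    rw [ge_iff_le, Pgeq_eq, magnetization_eq, magnetization_eq, Finset.mul_sum,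
      ← Finset.sum_sub_distrib]
    refine Finset.sum_le_sum fun ω _ => ?_
    have h := mul_le_mul_of_nonneg_left
      (pointwise_two k γ γt h0 h1 ht0 ht1 (cluster G ω x₀).card)
      (weight_nonneg' G p hp0 hp1 ω)
    linarith
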